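/- Let A be a commutative ring and let R be a commutative Hopf algebra over A (with comultiplication Δ, counit ε, and antipode) which is flat as an A-module, and let M be an A-module. Call an R-module automorphism α of M ⊗_A R a descent datum if: (i) the base change of α along the counit ε : R → A is the identity of M (under M ⊗_A R ⊗_{R,ε} A ≅ M); and (ii) writing α₁, α₂, α_Δ for the base changes of α to M ⊗_A (R ⊗_A R) along the three A-algebra homomorphisms R → R ⊗_A R given by r ↦ r ⊗ 1, r ↦ 1 ⊗ r, and Δ respectively, one has α₁ ∘ α₂ = α_Δ. Then the assignments ρ ↦ α_ρ (where α_ρ is the unique R-linear endomorphism of M ⊗_A R with α_ρ(m ⊗ 1) = ρ(m), which is automatically an automorphism) and α ↦ (m ↦ α(m ⊗ 1)) are mutually inverse bijections between right comodule structures on M and descent data on M ⊗_A R. -/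

import Mathlib

open TensorProduct

/-- `β : M ⊗[A] S → M ⊗[A] S` is `S`-linear for the `S`-module structure coming from
multiplication on the right tensor factor. -/
def IsLinearOverAux (A M S : Type*) [CommRing A] [AddCommGroup M] [Module A M]
    [CommRing S] [Algebra A S] (β : M ⊗[A] S →ₗ[A] M ⊗[A] S) : Prop :=
  ∀ (s : S) (x : M ⊗[A] S),
    β (LinearMap.lTensor M (LinearMap.mulRight A s) x) =
      LinearMap.lTensor M (LinearMap.mulRight A s) (β x)

/-- A right comodule structure on `M` over the Hopf algebra `R`: an `A`-linear map
`ρ : M → M ⊗[A] R` satisfying the counit axiom and the coassociativity axiom. -/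
def IsComoduleStructure (A R M : Type*) [CommRing A] [CommRing R] [HopfAlgebra A R]
    [AddCommGroup M] [Module A M] (ρ : M →ₗ[A] M ⊗[A] R) : Prop :=
  ((TensorProduct.rid A M).toLinearMap ∘ₗ
      LinearMap.lTensor M (Coalgebra.counit : R →ₗ[A] A) ∘ₗ ρ = LinearMap.id) ∧
  (LinearMap.lTensor M (Coalgebra.comul : R →ₗ[A] R ⊗[A] R) ∘ₗ ρ =
    (TensorProduct.assoc A M R R).toLinearMap ∘ₗ LinearMap.rTensor R ρ ∘ₗ ρ)

/-- A descent datum on `M ⊗[A] R`: a bijective `R`-linear endomorphism `α` whose base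
change along the counit `ε : R → A` is the identity of `M`, and whose base changes
`α₁, α₂, α_Δ` to `M ⊗[A] (R ⊗[A] R)` along `r ↦ r ⊗ 1`, `r ↦ 1 ⊗ r` and the
comultiplication `Δ` satisfy the cocycle condition `α₁ ∘ α₂ = α_Δ`.  (The base change of
`α` along an `A`-algebra map `φ : R → S` is the unique `S`-linear endomorphism `β` of
`M ⊗[A] S` with `β (m ⊗ 1) = (id_M ⊗ φ)(α (m ⊗ 1))`.) -/
def IsDescentDatum (A R M : Type*) [CommRing A] [CommRing R] [HopfAlgebra A R]
    [AddCommGroup M] [Module A M] (α : M ⊗[A] R →ₗ[A] M ⊗[A] R) : Prop :=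
  IsLinearOverAux A M R α ∧ Function.Bijective α ∧
    (∀ m : M, (TensorProduct.rid A M)
        (LinearMap.lTensor M (Coalgebra.counit : R →ₗ[A] A) (α (m ⊗ₜ[A] (1 : R)))) = m) ∧
    (∀ β₁ β₂ βΔ : M ⊗[A] (R ⊗[A] R) →ₗ[A] M ⊗[A] (R ⊗[A] R),
      IsLinearOverAux A M (R ⊗[A] R) β₁ → IsLinearOverAux A M (R ⊗[A] R) β₂ →
      IsLinearOverAux A M (R ⊗[A] R) βΔ →
      (∀ m : M, β₁ (m ⊗ₜ[A] (1 : R ⊗[A] R)) =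
        LinearMap.lTensor M
          (Algebra.TensorProduct.includeLeft : R →ₐ[A] R ⊗[A] R).toLinearMap
          (α (m ⊗ₜ[A] (1 : R)))) →
      (∀ m : M, β₂ (m ⊗ₜ[A] (1 : R ⊗[A] R)) =
        LinearMap.lTensor M
          (Algebra.TensorProduct.includeRight : R →ₐ[A] R ⊗[A] R).toLinearMap
          (α (m ⊗ₜ[A] (1 : R)))) →
      (∀ m : M, βΔ (m ⊗ₜ[A] (1 : R ⊗[A] R)) =
        LinearMap.lTensor M (Bialgebra.comulAlgHom A R).toLinearMap
          (α (m ⊗ₜ[A] (1 : R)))) →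
      β₁ ∘ₗ β₂ = βΔ)

section LinearExtension

variable {A M S : Type*} [CommRing A] [AddCommGroup M] [Module A M] [CommRing S] [Algebra A S]

/-- The `S`-linear extension `m ⊗ s ↦ f m * s` of an `A`-linear map `f : M → M ⊗[A] S`. -/
noncomputable def linearExtension (f : M →ₗ[A] M ⊗[A] S) : M ⊗[A] S →ₗ[A] M ⊗[A] S :=
  LinearMap.lTensor M (LinearMap.mul' A S) ∘ₗ
    (TensorProduct.assoc A M S S).toLinearMap ∘ₗ LinearMap.rTensor S f

lemma lTensor_mul'_assoc_tmul (y : M ⊗[A] S) (s : S) :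
    LinearMap.lTensor M (LinearMap.mul' A S) (TensorProduct.assoc A M S S (y ⊗ₜ[A] s)) =
      LinearMap.lTensor M (LinearMap.mulRight A s) y := by
  induction y with
  | zero => simp
  | tmul m r => simp
  | add y z hy hz => simp only [TensorProduct.add_tmul, map_add, hy, hz]

lemma linearExtension_tmul (f : M →ₗ[A] M ⊗[A] S) (m : M) (s : S) :
    linearExtension f (m ⊗ₜ[A] s) = LinearMap.lTensor M (LinearMap.mulRight A s) (f m) := by
  simp [linearExtension, lTensor_mul'_assoc_tmul]

lemma linearExtension_tmul_one (f : M →ₗ[A] M ⊗[A] S) (m : M) :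
    linearExtension f (m ⊗ₜ[A] (1 : S)) = f m := by
  simp [linearExtension_tmul]

lemma isLinearOverAux_linearExtension (f : M →ₗ[A] M ⊗[A] S) :
    IsLinearOverAux A M S (linearExtension f) := by
  intro s x
  induction x with
  | zero => simp
  | tmul m r =>
    rw [LinearMap.lTensor_tmul, linearExtension_tmul, linearExtension_tmul,
      LinearMap.mulRight_apply, LinearMap.mulRight_mul, LinearMap.lTensor_comp,
      LinearMap.comp_apply]
  | add x y hx hy => simp only [map_add, hx, hy]

lemma IsLinearOverAux.eq_linearExtension {β : M ⊗[A] S →ₗ[A] M ⊗[A] S}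
    (hβ : IsLinearOverAux A M S β) {f : M →ₗ[A] M ⊗[A] S}
    (h : ∀ m : M, β (m ⊗ₜ[A] (1 : S)) = f m) : β = linearExtension f := by
  refine TensorProduct.ext' fun m s => ?_
  have := hβ s (m ⊗ₜ[A] (1 : S))
  rw [h, LinearMap.lTensor_tmul, LinearMap.mulRight_apply, one_mul] at this
  rw [this, linearExtension_tmul]

lemma IsLinearOverAux.comp {β γ : M ⊗[A] S →ₗ[A] M ⊗[A] S}
    (hβ : IsLinearOverAux A M S β) (hγ : IsLinearOverAux A M S γ) :
    IsLinearOverAux A M S (β ∘ₗ γ) := by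
  intro s x
  rw [LinearMap.comp_apply, LinearMap.comp_apply, hγ, hβ]

lemma IsLinearOverAux.ext {β γ : M ⊗[A] S →ₗ[A] M ⊗[A] S}
    (hβ : IsLinearOverAux A M S β) (hγ : IsLinearOverAux A M S γ)
    (h : ∀ m : M, β (m ⊗ₜ[A] (1 : S)) = γ (m ⊗ₜ[A] (1 : S))) : β = γ := by
  rw [hγ.eq_linearExtension (f := γ ∘ₗ (TensorProduct.mk A M S).flip 1) fun m => rfl]
  exact hβ.eq_linearExtension h

lemma isLinearOverAux_id : IsLinearOverAux A M S LinearMap.id := fun _ _ => rfl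

lemma linearExtension_lTensor {N P : Type*} [AddCommGroup N] [Module A N]
    [AddCommGroup P] [Module A P] (f : M →ₗ[A] M ⊗[A] N) (g : N →ₗ[A] S) (h : P →ₗ[A] S)
    (x : M ⊗[A] P) :
    linearExtension (LinearMap.lTensor M g ∘ₗ f) (LinearMap.lTensor M h x) =
      LinearMap.lTensor M (LinearMap.mul' A S ∘ₗ TensorProduct.map g h)
        (TensorProduct.assoc A M N P (LinearMap.rTensor P f x)) := by
  induction x with
  | zero => simp
  | tmul m p =>
    rw [LinearMap.lTensor_tmul, linearExtension_tmul, LinearMap.rTensor_tmul,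
      LinearMap.comp_apply]
    generalize f m = y
    induction y with
    | zero => simp
    | tmul m r => simp
    | add y z hy hz => simp only [TensorProduct.add_tmul, map_add, hy, hz]
  | add x y hx hy => simp only [map_add, hx, hy]

end LinearExtension

section Comodule

variable {A R M : Type*} [CommRing A] [CommRing R] [HopfAlgebra A R]
  [AddCommGroup M] [Module A M]

lemma mul'_comp_map_includeLeft_includeRight :
    LinearMap.mul' A (R ⊗[A] R) ∘ₗ TensorProduct.map
      (Algebra.TensorProduct.includeLeft : R →ₐ[A] R ⊗[A] R).toLinearMap
      (Algebra.TensorProduct.includeRight : R →ₐ[A] R ⊗[A] R).toLinearMap =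
    LinearMap.id := by
  ext r s
  simp

lemma linearExtension_lTensor_of_isComoduleStructure {S : Type*} [CommRing S] [Algebra A S]
    {ρ : M →ₗ[A] M ⊗[A] R} (hρ : IsComoduleStructure A R M ρ) (g h : R →ₗ[A] S) (m : M) :
    linearExtension (LinearMap.lTensor M g ∘ₗ ρ) (LinearMap.lTensor M h (ρ m)) =
      LinearMap.lTensor M (LinearMap.mul' A S ∘ₗ TensorProduct.map g h ∘ₗ Coalgebra.comul)
        (ρ m) := by
  have := LinearMap.congr_fun hρ.2 m
  simp only [LinearMap.comp_apply, LinearEquiv.coe_coe] at this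
  rw [linearExtension_lTensor, ← this, ← LinearMap.lTensor_comp_apply, LinearMap.comp_assoc]

lemma lTensor_algebraLinearMap_counit {ρ : M →ₗ[A] M ⊗[A] R}
    (hρ : IsComoduleStructure A R M ρ) (m : M) :
    LinearMap.lTensor M (Algebra.linearMap A R ∘ₗ Coalgebra.counit) (ρ m) =
      m ⊗ₜ[A] (1 : R) := by
  have h := LinearMap.congr_fun hρ.1 m
  simp only [LinearMap.comp_apply, LinearEquiv.coe_coe, LinearMap.id_apply] at h
  rw [LinearMap.lTensor_comp_apply, (LinearEquiv.eq_symm_apply _).2 h]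
  simp

lemma bijective_linearExtension {ρ : M →ₗ[A] M ⊗[A] R} (hρ : IsComoduleStructure A R M ρ) :
    Function.Bijective (linearExtension ρ) := by
  set σ : M →ₗ[A] M ⊗[A] R := LinearMap.lTensor M (HopfAlgebra.antipode A) ∘ₗ ρ
  have hid : LinearMap.lTensor M (LinearMap.id : R →ₗ[A] R) ∘ₗ ρ = ρ := by
    rw [LinearMap.lTensor_id, LinearMap.id_comp]
  have left : linearExtension σ ∘ₗ linearExtension ρ = LinearMap.id := by
    refine ((isLinearOverAux_linearExtension σ).comp (isLinearOverAux_linearExtension ρ)).ext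
      isLinearOverAux_id fun m => ?_
    have := linearExtension_lTensor_of_isComoduleStructure hρ (HopfAlgebra.antipode A)
      LinearMap.id m
    rw [← LinearMap.rTensor_def, HopfAlgebra.mul_antipode_rTensor_comul,
      lTensor_algebraLinearMap_counit hρ, LinearMap.lTensor_id] at this
    rw [LinearMap.comp_apply, linearExtension_tmul_one]
    exact this
  have right : linearExtension ρ ∘ₗ linearExtension σ = LinearMap.id := by
    refine ((isLinearOverAux_linearExtension ρ).comp (isLinearOverAux_linearExtension σ)).ext
      isLinearOverAux_id fun m => ?_
    have := linearExtension_lTensor_of_isComoduleStructure hρ LinearMap.id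
      (HopfAlgebra.antipode A) m
    rw [← LinearMap.lTensor_def, HopfAlgebra.mul_antipode_lTensor_comul,
      lTensor_algebraLinearMap_counit hρ, hid] at this
    rw [LinearMap.comp_apply, linearExtension_tmul_one]
    exact this
  exact Function.bijective_iff_has_inverse.2
    ⟨linearExtension σ, LinearMap.congr_fun left, LinearMap.congr_fun right⟩

lemma linearExtension_includeLeft_includeRight (ρ : M →ₗ[A] M ⊗[A] R) (x : M ⊗[A] R) :
    linearExtension (LinearMap.lTensor M
        (Algebra.TensorProduct.includeLeft : R →ₐ[A] R ⊗[A] R).toLinearMap ∘ₗ ρ)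
      (LinearMap.lTensor M
        (Algebra.TensorProduct.includeRight : R →ₐ[A] R ⊗[A] R).toLinearMap x) =
      TensorProduct.assoc A M R R (LinearMap.rTensor R ρ x) := by
  rw [linearExtension_lTensor, mul'_comp_map_includeLeft_includeRight, LinearMap.lTensor_id,
    LinearMap.id_apply]

lemma IsComoduleStructure.isDescentDatum {ρ : M →ₗ[A] M ⊗[A] R}
    (hρ : IsComoduleStructure A R M ρ) : IsDescentDatum A R M (linearExtension ρ) := by
  refine ⟨isLinearOverAux_linearExtension ρ, bijective_linearExtension hρ, fun m => ?_, ?_⟩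
  · rw [linearExtension_tmul_one]
    exact LinearMap.congr_fun hρ.1 m
  · intro β₁ β₂ βΔ l₁ l₂ lΔ h₁ h₂ hΔ
    simp only [linearExtension_tmul_one] at h₁ h₂ hΔ
    refine (l₁.comp l₂).ext lΔ fun m => ?_
    rw [LinearMap.comp_apply, h₂, hΔ, l₁.eq_linearExtension (f := LinearMap.lTensor M
      (Algebra.TensorProduct.includeLeft : R →ₐ[A] R ⊗[A] R).toLinearMap ∘ₗ ρ) h₁,
      linearExtension_includeLeft_includeRight]
    exact (LinearMap.congr_fun hρ.2 m).symm

lemma IsDescentDatum.isComoduleStructure {α : M ⊗[A] R →ₗ[A] M ⊗[A] R}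
    (hα : IsDescentDatum A R M α) :
    IsComoduleStructure A R M (α ∘ₗ (TensorProduct.mk A M R).flip 1) := by
  obtain ⟨-, -, hcounit, hcocycle⟩ := hα
  refine ⟨LinearMap.ext hcounit, LinearMap.ext fun m => ?_⟩
  set ρ := α ∘ₗ (TensorProduct.mk A M R).flip 1
  have h := hcocycle
    (linearExtension (LinearMap.lTensor M
      (Algebra.TensorProduct.includeLeft : R →ₐ[A] R ⊗[A] R).toLinearMap ∘ₗ ρ))
    (linearExtension (LinearMap.lTensor M
      (Algebra.TensorProduct.includeRight : R →ₐ[A] R ⊗[A] R).toLinearMap ∘ₗ ρ))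
    (linearExtension (LinearMap.lTensor M (Bialgebra.comulAlgHom A R).toLinearMap ∘ₗ ρ))
    (isLinearOverAux_linearExtension _) (isLinearOverAux_linearExtension _)
    (isLinearOverAux_linearExtension _) (linearExtension_tmul_one _)
    (linearExtension_tmul_one _) (linearExtension_tmul_one _)
  have hm := LinearMap.congr_fun h (m ⊗ₜ[A] (1 : R ⊗[A] R))
  rw [LinearMap.comp_apply, linearExtension_tmul_one, linearExtension_tmul_one,
    LinearMap.comp_apply, linearExtension_includeLeft_includeRight] at hm
  exact hm.symm

end Comodule

/-- Faithfully flat descent along `Spec R ⊗ ? → BG`: for a commutative Hopf algebra `R`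
flat over `A` and an `A`-module `M`, the assignments `ρ ↦ α_ρ` (where `α_ρ` is the unique
`R`-linear endomorphism of `M ⊗[A] R` with `α_ρ (m ⊗ 1) = ρ m`, automatically an
automorphism) and `α ↦ (m ↦ α (m ⊗ 1))` are mutually inverse bijections between right
comodule structures on `M` and descent data on `M ⊗[A] R`. -/
theorem statement1 (A R M : Type*) [CommRing A] [CommRing R] [HopfAlgebra A R]
    [Module.Flat A R] [AddCommGroup M] [Module A M] :
    ∃ e : {ρ : M →ₗ[A] M ⊗[A] R // IsComoduleStructure A R M ρ} ≃
        {α : M ⊗[A] R →ₗ[A] M ⊗[A] R // IsDescentDatum A R M α},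
      (∀ (ρ : {ρ : M →ₗ[A] M ⊗[A] R // IsComoduleStructure A R M ρ}) (m : M),
        (e ρ).1 (m ⊗ₜ[A] (1 : R)) = ρ.1 m) ∧
      (∀ (α : {α : M ⊗[A] R →ₗ[A] M ⊗[A] R // IsDescentDatum A R M α}) (m : M),
        (e.symm α).1 m = α.1 (m ⊗ₜ[A] (1 : R))) ∧
      (∀ (ρ : {ρ : M →ₗ[A] M ⊗[A] R // IsComoduleStructure A R M ρ})
          (α : M ⊗[A] R →ₗ[A] M ⊗[A] R),
        IsLinearOverAux A M R α → (∀ m : M, α (m ⊗ₜ[A] (1 : R)) = ρ.1 m) →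
        α = (e ρ).1) := by
  refine ⟨{ toFun := fun ρ => ⟨linearExtension ρ.1, ρ.2.isDescentDatum⟩
            invFun := fun α => ⟨α.1 ∘ₗ (TensorProduct.mk A M R).flip 1, α.2.isComoduleStructure⟩
            left_inv := fun ρ => Subtype.ext (LinearMap.ext (linearExtension_tmul_one ρ.1))
            right_inv := fun α =>
              Subtype.ext (α.2.1.eq_linearExtension fun _ => rfl).symm },
    fun ρ => linearExtension_tmul_one ρ.1, fun _ _ => rfl,
    fun _ _ hα h => hα.eq_linearExtension h⟩
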